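/- arXiv:1803.00963 — 2 statements merged into one kernel-verified Lean document; each statement's English description precedes it below -/
import Mathlib

section
/- Let f : ℂ → ℂ be a nonconstant entire function, let a₁, …, a_q be distinct complex numbers and m₁, …, m_q integers with m_k ≥ 2 such that for each k, every z with f(z) = a_k satisfies f^{(j)}(z) = 0 for all 1 ≤ j ≤ m_k − 1. Then Σ_{k=1}^{q} (1 − 1/m_k) ≤ 1. (This is Nevanlinna's criterion, Theorem 2.1 of the paper, specialized to parabolic surfaces arising from entire functions: if the sum over all totally ramified values including ∞ exceeded 2, the surface would be hyperbolic.) -/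
open Filter Topology Finset

lemma nev_local_max {q : ℕ} (z0 : ℂ) (R : ℝ) (hR : ‖z0‖ < R) (P : ℂ → ℂ) (hP : AnalyticAt ℂ P z0)
    (hP0 : P z0 ≠ 0)
    (g : Fin q → ℂ → ℂ) (hg : ∀ j, AnalyticAt ℂ (g j) z0)
    (hmax : ∀ᶠ z in 𝓝 z0, ‖P z‖ * (∏ j, (1 + ‖g j z‖ ^ 2)) * (R ^ 2 - ‖z‖ ^ 2) ≤
      ‖P z0‖ * (∏ j, (1 + ‖g j z0‖ ^ 2)) * (R ^ 2 - ‖z0‖ ^ 2)) (k : Fin q) :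
    ‖deriv (g k) z0‖ * (R ^ 2 - ‖z0‖ ^ 2) ≤ R * (1 + ‖g k z0‖ ^ 2) := by
  by_contra! hlt
  have hRpos : 0 < R := lt_of_le_of_lt (norm_nonneg _) hR
  have hd0 : 0 < R ^ 2 - ‖z0‖ ^ 2 := by
    have := norm_nonneg z0
    nlinarith
  set A : Fin q → ℂ → ℂ := fun j z => 1 + (starRingEnd ℂ) (g j z0) * g j z with hA
  set B : ℂ → ℂ := fun z => (R : ℂ) ^ 2 - (starRingEnd ℂ) z0 * z with hB
  have idA : ∀ j z, (1 + ‖g j z0‖ ^ 2) * (1 + ‖g j z‖ ^ 2) = ‖A j z‖ ^ 2 + ‖g j z - g j z0‖ ^ 2 := by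
    intro j z
    simp only [hA, ← Complex.normSq_eq_norm_sq, Complex.normSq_apply]
    simp
    ring
  have idB : ∀ z, (R ^ 2 - ‖z0‖ ^ 2) * (R ^ 2 - ‖z‖ ^ 2) = ‖B z‖ ^ 2 - R ^ 2 * ‖z - z0‖ ^ 2 := by
    intro z
    simp only [hB, ← Complex.normSq_eq_norm_sq, Complex.normSq_apply]
    simp [pow_two]
    ring
  have pos1 : ∀ j, 0 < 1 + ‖g j z0‖ ^ 2 := fun j => by positivity
  have A0 : ∀ j, ‖A j z0‖ = 1 + ‖g j z0‖ ^ 2 := by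
    intro j
    have := idA j z0
    simp only [sub_self, norm_zero] at this
    have h3 := pos1 j
    have h4 := norm_nonneg (A j z0)
    nlinarith
  have B0 : ‖B z0‖ = R ^ 2 - ‖z0‖ ^ 2 := by
    have := idB z0
    simp only [sub_self, norm_zero] at this
    have h4 := norm_nonneg (B z0)
    nlinarith
  have anA : ∀ j, AnalyticAt ℂ (A j) z0 := fun j => by
    have := hg j
    fun_prop
  have anB : AnalyticAt ℂ B z0 := by fun_prop
  set Q : ℂ → ℂ := fun z => P z * (∏ j, (A j z) ^ 2) * (B z) ^ 2 with hQ
  have anQ : AnalyticAt ℂ Q z0 := by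
    refine (hP.mul ?_).mul (anB.pow 2)
    exact Finset.analyticAt_fun_prod _ (fun j _ => (anA j).pow 2)
  -- the constant
  set c : ℝ := (∏ j, (1 + ‖g j z0‖ ^ 2)) * (R ^ 2 - ‖z0‖ ^ 2) with hc
  have hcpos : 0 < c := mul_pos (Finset.prod_pos fun j _ => pos1 j) hd0
  set t : ℂ → ℝ := fun z => ‖dslope (g k) z0 z‖ ^ 2 with ht
  -- lower bound
  have key : ∀ᶠ z in 𝓝 z0, 0 < t z * ‖B z‖ ^ 2 - R ^ 2 * ‖A k z‖ ^ 2 - t z * R ^ 2 * ‖z - z0‖ ^ 2 := by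
    have hcont : ContinuousAt (fun z => t z * ‖B z‖ ^ 2 - R ^ 2 * ‖A k z‖ ^ 2
        - t z * R ^ 2 * ‖z - z0‖ ^ 2) z0 := by
      have h1 : ContinuousAt (dslope (g k) z0) z0 :=
        continuousAt_dslope_same.2 (hg k).differentiableAt
      have h2 := anB.continuousAt
      have h3 := (anA k).continuousAt
      simp only [ht]
      fun_prop
    refine hcont.eventually_const_lt ?_
    simp only [ht, dslope_same, sub_self, norm_zero, A0, B0]
    have := mul_pos hRpos (pos1 k)
    have := mul_self_lt_mul_self this.le hlt
    nlinarith
  have hBR : ∀ᶠ z in 𝓝 z0, 0 < ‖A k z‖ := by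
    refine (anA k).continuousAt.norm.eventually_const_lt ?_
    change 0 < ‖A k z0‖
    rw [A0]; exact pos1 k
  have hRz : ∀ᶠ z in 𝓝 z0, ‖z‖ < R := continuous_norm.continuousAt.eventually_lt_const hR
  have hPz : ∀ᶠ z in 𝓝 z0, P z ≠ 0 := hP.continuousAt.eventually_ne hP0
  have hstrict : ∀ᶠ z in 𝓝 z0, z ≠ z0 → ‖Q z‖ < ‖Q z0‖ := by
    filter_upwards [key, hBR, hRz, hmax, hPz] with z h1 h2 h3 h4 h5 hne
    have hQ0 : ‖Q z0‖ = c * (‖P z0‖ * (∏ j, (1 + ‖g j z0‖ ^ 2)) * (R ^ 2 - ‖z0‖ ^ 2)) := by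
      simp only [hQ, norm_mul, norm_prod, norm_pow, A0, B0, hc, Finset.prod_pow]
      ring
    have hzz : 0 < ‖z - z0‖ ^ 2 := by
      have := norm_pos_iff.2 (sub_ne_zero.2 hne)
      positivity
    have hT : ‖g k z - g k z0‖ ^ 2 = t z * ‖z - z0‖ ^ 2 := by
      simp only [ht]
      rw [← sub_smul_dslope, norm_smul]; ring
    have hdz : 0 < R ^ 2 - ‖z‖ ^ 2 := by
      have := norm_nonneg z
      nlinarith
    have hprod : (∏ j, ‖A j z‖ ^ 2) * ‖B z‖ ^ 2 <
        c * ((∏ j, (1 + ‖g j z‖ ^ 2)) * (R ^ 2 - ‖z‖ ^ 2)) := by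
      have e1 : c * ((∏ j, (1 + ‖g j z‖ ^ 2)) * (R ^ 2 - ‖z‖ ^ 2)) =
          (∏ j, (‖A j z‖ ^ 2 + ‖g j z - g j z0‖ ^ 2)) * (‖B z‖ ^ 2 - R ^ 2 * ‖z - z0‖ ^ 2) := by
        rw [hc, ← idB, Finset.prod_congr rfl (fun j _ => (idA j z).symm), Finset.prod_mul_distrib]
        ring
      rw [e1, ← Finset.mul_prod_erase _ _ (Finset.mem_univ k),
        ← Finset.mul_prod_erase univ (fun j => ‖A j z‖ ^ 2 + ‖g j z - g j z0‖ ^ 2) (Finset.mem_univ k), hT]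
      have q1 : (∏ j ∈ univ.erase k, ‖A j z‖ ^ 2) ≤
          ∏ j ∈ univ.erase k, (‖A j z‖ ^ 2 + ‖g j z - g j z0‖ ^ 2) :=
        Finset.prod_le_prod (fun j _ => by positivity)
          (fun j _ => le_add_of_nonneg_right (by positivity))
      have q2 : 0 < ∏ j ∈ univ.erase k, (‖A j z‖ ^ 2 + ‖g j z - g j z0‖ ^ 2) := by
        refine Finset.prod_pos fun j _ => ?_
        rw [← idA]; positivity
      have q3 : ‖A k z‖ ^ 2 * ‖B z‖ ^ 2 <
          (‖A k z‖ ^ 2 + t z * ‖z - z0‖ ^ 2) * (‖B z‖ ^ 2 - R ^ 2 * ‖z - z0‖ ^ 2) := by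
        have := mul_pos hzz h1
        linarith
      calc _ = (‖A k z‖ ^ 2 * ‖B z‖ ^ 2) * (∏ j ∈ univ.erase k, ‖A j z‖ ^ 2) := by ring
        _ ≤ (‖A k z‖ ^ 2 * ‖B z‖ ^ 2) *
            ∏ j ∈ univ.erase k, (‖A j z‖ ^ 2 + ‖g j z - g j z0‖ ^ 2) :=
          mul_le_mul_of_nonneg_left q1 (by positivity)
        _ < _ := mul_lt_mul_of_pos_right q3 q2
        _ = _ := by ring
    calc ‖Q z‖ = ‖P z‖ * ((∏ j, ‖A j z‖ ^ 2) * ‖B z‖ ^ 2) := by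
          simp only [hQ, norm_mul, norm_prod, norm_pow]; ring
      _ < ‖P z‖ * (c * ((∏ j, (1 + ‖g j z‖ ^ 2)) * (R ^ 2 - ‖z‖ ^ 2))) :=
          mul_lt_mul_of_pos_left hprod (norm_pos_iff.2 h5)
      _ = c * (‖P z‖ * (∏ j, (1 + ‖g j z‖ ^ 2)) * (R ^ 2 - ‖z‖ ^ 2)) := by ring
      _ ≤ ‖Q z0‖ := by rw [hQ0]; exact mul_le_mul_of_nonneg_left h4 hcpos.le
  have hloc : IsLocalMax (norm ∘ Q) z0 := by
    filter_upwards [hstrict] with z hz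
    rcases eq_or_ne z z0 with rfl | h
    · rfl
    · exact (hz h).le
  have heq := Complex.eventually_eq_of_isLocalMax_norm
    (anQ.eventually_analyticAt.mono fun z hz => hz.differentiableAt) hloc
  have h2 : ∀ᶠ z in 𝓝[≠] z0, False := by
    have h3 := heq.and hstrict
    filter_upwards [h3.filter_mono nhdsWithin_le_nhds, self_mem_nhdsWithin] with z hz hne
    have := hz.2 hne
    rw [hz.1] at this
    exact lt_irrefl _ this
  exact h2.exists.choose_spec

lemma nev_branch (f : ℂ → ℂ) (hf : Differentiable ℂ f) (z0 a : ℂ) (h : f z0 ≠ a) (s : ℝ) :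
    ∃ g : ℂ → ℂ, AnalyticAt ℂ g z0 ∧ (∀ z, ‖g z‖ = ‖f z - a‖ ^ s) ∧
      ‖deriv g z0‖ = |s| * ‖f z0 - a‖ ^ (s - 1) * ‖deriv f z0‖ := by
  have h0 : f z0 - a ≠ 0 := sub_ne_zero.2 h
  have hn : 0 < ‖f z0 - a‖ := norm_pos_iff.2 h0
  have hd : HasDerivAt (fun z => ((‖f z0 - a‖ ^ s : ℝ) : ℂ) * ((f z - a) / (f z0 - a)) ^ (s : ℂ))
      (((‖f z0 - a‖ ^ s : ℝ) : ℂ) * ((s : ℂ) * ((f z0 - a) / (f z0 - a)) ^ ((s : ℂ) - 1) *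
        (deriv f z0 / (f z0 - a)))) z0 := by
    refine HasDerivAt.const_mul _ ?_
    refine HasDerivAt.cpow_const (((hf z0).hasDerivAt.sub_const a).div_const _) ?_
    rw [div_self h0]; simp
  refine ⟨fun z => ((‖f z0 - a‖ ^ s : ℝ) : ℂ) * ((f z - a) / (f z0 - a)) ^ (s : ℂ), ?_, ?_, ?_⟩
  · refine analyticAt_const.mul (AnalyticAt.cpow ?_ analyticAt_const ?_)
    · exact (((hf.analyticAt z0)).sub analyticAt_const).div_const
    · rw [div_self h0]; simp
  · intro z
    rw [norm_mul, Complex.norm_cpow_real, norm_div, Real.div_rpow (norm_nonneg _) (norm_nonneg _),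
      Complex.norm_real, Real.norm_of_nonneg (by positivity)]
    have : 0 < ‖f z0 - a‖ ^ s := by positivity
    field_simp
  · rw [hd.deriv, div_self h0, norm_mul, norm_mul, norm_mul, norm_div, Complex.one_cpow,
      Complex.norm_real, Real.norm_of_nonneg (by positivity), Real.rpow_sub_one hn.ne']
    simp
    ring

lemma nev_cont (f : ℂ → ℂ) (hf : Differentiable ℂ f) (hnc : ∃ z w : ℂ, f z ≠ f w) (z0 a : ℂ)
    (h : f z0 = a) (m : ℕ) (hm : 2 ≤ m) (hram : ∀ j : ℕ, 1 ≤ j → j ≤ m - 1 → iteratedDeriv j f z0 = 0)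
    (α : ℝ) (hα0 : 0 < α) (hα : α < 1 - 1 / (m : ℝ)) :
    Tendsto (fun z => ‖f z - a‖ ^ (-α) * ‖deriv f z‖) (𝓝 z0) (𝓝 0) := by
  have han : AnalyticAt ℂ (fun z => f z - a) z0 := (hf.analyticAt z0).sub analyticAt_const
  have hne : analyticOrderAt (fun z => f z - a) z0 ≠ ⊤ := by
    intro htop
    rw [analyticOrderAt_eq_top] at htop
    have h1 : AnalyticOnNhd ℂ (fun z => f z - a) Set.univ :=
      fun z _ => (hf.analyticAt z).sub analyticAt_const
    have h2 := h1.eqOn_zero_of_preconnected_of_eventuallyEq_zero isPreconnected_univ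
      (Set.mem_univ z0) htop
    obtain ⟨z, w, hzw⟩ := hnc
    have e1 := h2 (Set.mem_univ z)
    have e2 := h2 (Set.mem_univ w)
    simp only [Pi.zero_apply, sub_eq_zero] at e1 e2
    exact hzw (e1.trans e2.symm)
  have hge : (m : ℕ∞) ≤ analyticOrderAt (fun z => f z - a) z0 := by
    rw [natCast_le_analyticOrderAt_iff_iteratedDeriv_eq_zero han]
    intro i hi
    rcases Nat.eq_zero_or_pos i with rfl | hi0
    · simp [h]
    · obtain ⟨l, rfl⟩ : ∃ l, i = l + 1 := ⟨i - 1, by omega⟩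
      have e : iteratedDeriv (l + 1) (fun z => f z - a) z0 = iteratedDeriv (l + 1) f z0 := by
        rw [iteratedDeriv_succ', iteratedDeriv_succ']
        congr 1
        funext z
        exact deriv_sub_const _
      rw [e]
      exact hram _ hi0 (by omega)
  obtain ⟨n, hn⟩ := ENat.ne_top_iff_exists.1 hne
  rw [← hn] at hge
  have hmn : m ≤ n := by exact_mod_cast hge
  obtain ⟨u, hu, hu0, hfu⟩ := (han.analyticOrderAt_eq_natCast).1 hn.symm
  have hderiv : ∀ᶠ z in 𝓝 z0, deriv f z = (z - z0) ^ (n - 1) * (n * u z + (z - z0) * deriv u z) := by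
    filter_upwards [hfu.eventually_nhds, hu.eventually_analyticAt] with z hz huz
    have e1 : f =ᶠ[𝓝 z] fun w => (w - z0) ^ n * u w + a := by
      filter_upwards [hz] with w hw
      rw [← smul_eq_mul, ← hw]; ring
    rw [e1.deriv_eq]
    have := ((((hasDerivAt_id z).sub_const z0).pow n).mul huz.differentiableAt.hasDerivAt).add_const a
    have := this.deriv
    simp only [Pi.mul_def, Pi.pow_def, id] at this
    rw [this]
    obtain ⟨l, rfl⟩ : ∃ l, n = l + 1 := ⟨n - 1, by omega⟩
    simp
    ring
  have hexp : 0 < (n : ℝ) - 1 - n * α := by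
    have hm' : (2:ℝ) ≤ m := by exact_mod_cast hm
    have hmn' : (m : ℝ) ≤ n := by exact_mod_cast hmn
    have h1 : (n:ℝ) * α < n * (1 - 1 / m) := mul_lt_mul_of_pos_left hα (by linarith)
    have h2 : (1:ℝ) ≤ n * (1 / m) := by
      rw [mul_one_div, le_div_iff₀ (by linarith)]; linarith
    linarith
  have hlim : Tendsto (fun z => ‖z - z0‖ ^ ((n : ℝ) - 1 - n * α) *
      (‖u z‖ ^ (-α) * ‖n * u z + (z - z0) * deriv u z‖)) (𝓝 z0) (𝓝 0) := by
    have hc : ContinuousAt (fun z => ‖z - z0‖ ^ ((n : ℝ) - 1 - n * α) *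
      (‖u z‖ ^ (-α) * ‖n * u z + (z - z0) * deriv u z‖)) z0 := by
      refine ContinuousAt.mul ?_ (ContinuousAt.mul ?_ ?_)
      · exact ContinuousAt.rpow_const (by fun_prop) (Or.inr hexp.le)
      · exact ContinuousAt.rpow_const hu.continuousAt.norm (Or.inl (norm_ne_zero_iff.2 hu0))
      · have := hu.continuousAt
        have := hu.deriv.continuousAt
        fun_prop
    have := hc.tendsto
    simpa [Real.zero_rpow hexp.ne'] using this
  refine hlim.congr' ?_
  filter_upwards [hfu, hderiv] with z h1 h2
  rcases eq_or_ne z z0 with rfl | hz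
  · have : n ≠ 0 := by omega
    have h4 : n - 1 ≠ 0 := by omega
    simp [h1, h2, Real.zero_rpow hexp.ne', h4]
  · have hz' : 0 < ‖z - z0‖ := norm_pos_iff.2 (sub_ne_zero.2 hz)
    rw [h1, h2, smul_eq_mul, norm_mul, norm_mul, norm_pow, norm_pow,
      Real.mul_rpow (by positivity) (by positivity), ← Real.rpow_natCast, ← Real.rpow_natCast,
      ← Real.rpow_mul hz'.le, Nat.cast_sub (by omega)]
    have : (n : ℝ) - 1 - n * α = n * (-α) + (n - (1:ℕ)) := by push_cast; ring
    rw [this, Real.rpow_add hz']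
    ring

lemma nev_bound {q : ℕ} (a : Fin q → ℂ) (ha : Function.Injective a) (hq : 0 < q) (α : Fin q → ℝ) (β : ℝ)
    (hα : ∀ k, 0 < α k) (hβ : 0 < β) (hαβ : ∀ k, α k + β ≤ 1)
    (hs : β * (2 * q + 1) ≤ ∑ k, α k - 1) :
    ∃ C : ℝ, 0 < C ∧ ∀ w : ℂ, (∀ k, w ≠ a k) → ∃ k,
      (∏ j, ((1 + ‖w - a j‖ ^ (2 * β)) * ‖w - a j‖ ^ (- α j))) ≤
        C * (‖w - a k‖ ^ (β - 1) / (1 + ‖w - a k‖ ^ (2 * β))) := by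
  have : Nonempty (Fin q) := ⟨⟨0, hq⟩⟩
  -- separation
  obtain ⟨d, hd, hsep⟩ : ∃ d : ℝ, 0 < d ∧ ∀ i j, i ≠ j → d ≤ ‖a i - a j‖ := by
    obtain ⟨x, hx⟩ := Finite.exists_min (fun p : Fin q × Fin q => if p.1 = p.2 then (1:ℝ) else ‖a p.1 - a p.2‖)
    refine ⟨min 1 (if x.1 = x.2 then (1:ℝ) else ‖a x.1 - a x.2‖), ?_, ?_⟩
    · refine lt_min one_pos ?_
      split_ifs with h
      · exact one_pos
      · exact norm_pos_iff.2 (sub_ne_zero.2 fun h' => h (ha h'))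
    · intro i j hij
      have := hx (i, j)
      simp only [hij, if_false] at this
      exact (min_le_right _ _).trans this
  obtain ⟨E, hE1, hE⟩ : ∃ E : ℝ, 1 ≤ E ∧ ∀ i j, ‖a i - a j‖ ≤ E := by
    obtain ⟨x, hx⟩ := Finite.exists_max (fun p : Fin q × Fin q => ‖a p.1 - a p.2‖)
    exact ⟨max 1 ‖a x.1 - a x.2‖, le_max_left _ _, fun i j => (hx (i, j)).trans (le_max_right _ _)⟩
  set K1 : ℝ := 2 * E ^ (2 * β) with hK1
  set K2 : ℝ := 1 + 2 / d with hK2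
  have hK1p : 0 < K1 := by positivity
  have hK2p : 1 ≤ K2 := by rw [hK2]; linarith [div_pos two_pos hd]
  refine ⟨K1 * (K1 * K2) ^ q, by positivity, ?_⟩
  intro w hw
  obtain ⟨k, hk⟩ := Finite.exists_min (fun j => ‖w - a j‖)
  refine ⟨k, ?_⟩
  have hr : ∀ j, 0 < ‖w - a j‖ := fun j => norm_pos_iff.2 (sub_ne_zero.2 (hw j))
  generalize hrdef : (fun j => ‖w - a j‖) = r at *
  have hrj : ∀ j, ‖w - a j‖ = r j := fun j => by rw [← hrdef]
  simp only [hrj] at hk hr ⊢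
  set X : ℝ := 1 + r k with hX
  have hX1 : 1 ≤ X := by linarith [hr k]
  have hX0 : 0 < X := by linarith
  have up : ∀ j, r j ≤ E * X := by
    intro j
    have h1 : r j ≤ r k + ‖a k - a j‖ := by
      rw [← hrj, ← hrj]
      calc ‖w - a j‖ = ‖(w - a k) + (a k - a j)‖ := by congr 1; ring
        _ ≤ _ := norm_add_le _ _
    have := hE k j
    have := hr k
    nlinarith
  have lo : ∀ j, j ≠ k → X ≤ K2 * r j := by
    intro j hjk
    have h1 : ‖a j - a k‖ ≤ r k + r j := by
      rw [← hrj, ← hrj]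
      calc ‖a j - a k‖ = ‖(w - a k) - (w - a j)‖ := by congr 1; ring
        _ ≤ _ := norm_sub_le _ _
    have h2 := hsep j k hjk
    have h3 := hk j
    have h4 : 1 ≤ 2 / d * r j := by
      rw [div_mul_eq_mul_div, le_div_iff₀ hd]; linarith
    rw [hX, hK2]; linarith
  have b1 : ∀ j, 1 + r j ^ (2 * β) ≤ K1 * X ^ (2 * β) := by
    intro j
    have h1 : r j ^ (2 * β) ≤ (E * X) ^ (2 * β) := Real.rpow_le_rpow (hr j).le (up j) (by positivity)
    have h2 : 1 ≤ (E * X) ^ (2 * β) := Real.one_le_rpow (by nlinarith) (by positivity)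
    rw [hK1, mul_assoc, ← Real.mul_rpow (by positivity) hX0.le]
    linarith
  have b2 : ∀ j, j ≠ k → r j ^ (- α j) ≤ K2 * X ^ (- α j) := by
    intro j hjk
    have h1 : X ^ α j ≤ (K2 * r j) ^ α j := Real.rpow_le_rpow hX0.le (lo j hjk) (hα j).le
    rw [Real.mul_rpow (by positivity) (hr j).le] at h1
    have h2 : K2 ^ α j ≤ K2 := by
      calc K2 ^ α j ≤ K2 ^ (1:ℝ) := Real.rpow_le_rpow_of_exponent_le hK2p (by linarith [hαβ j])
        _ = K2 := Real.rpow_one _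
    rw [Real.rpow_neg (hr j).le, Real.rpow_neg hX0.le, ← div_eq_mul_inv, inv_eq_one_div,
      div_le_div_iff₀ (Real.rpow_pos_of_pos (hr j) _) (Real.rpow_pos_of_pos hX0 _), one_mul]
    exact h1.trans (mul_le_mul_of_nonneg_right h2 (Real.rpow_pos_of_pos (hr j) _).le)
  have b3 : r k ^ (- α k) ≤ X ^ (1 - β - α k) * r k ^ (β - 1) := by
    have h1 : r k ^ (1 - β - α k) ≤ X ^ (1 - β - α k) :=
      Real.rpow_le_rpow (hr k).le (by linarith) (by linarith [hαβ k])
    calc r k ^ (- α k) = r k ^ (1 - β - α k) * r k ^ (β - 1) := by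
          rw [← Real.rpow_add (hr k)]; congr 1; ring
      _ ≤ _ := mul_le_mul_of_nonneg_right h1 (Real.rpow_pos_of_pos (hr k) _).le
  have b4 : ∀ j, (1 + r j ^ (2 * β)) * r j ^ (- α j) ≤
      (K1 * K2) * X ^ (2 * β - α j) * (if j = k then X ^ (1 - β) * r k ^ (β - 1) else 1) := by
    intro j
    have p1 : 0 < X ^ (2 * β) := Real.rpow_pos_of_pos hX0 _
    have p2 : 0 < X ^ (- α j) := Real.rpow_pos_of_pos hX0 _
    have p3 : 0 < r j ^ (- α j) := Real.rpow_pos_of_pos (hr j) _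
    have p4 : 0 < r k ^ (β - 1) := Real.rpow_pos_of_pos (hr k) _
    have p5 : 0 < X ^ (1 - β) := Real.rpow_pos_of_pos hX0 _
    rw [sub_eq_add_neg (2 * β), Real.rpow_add hX0]
    split_ifs with hjk
    · subst hjk
      have e : X ^ (1 - β - α j) = X ^ (1 - β) * X ^ (- α j) := by
        rw [← Real.rpow_add hX0]; congr 1
      rw [e] at b3
      calc (1 + r j ^ (2 * β)) * r j ^ (- α j) ≤
          (K1 * X ^ (2 * β)) * (X ^ (1 - β) * X ^ (- α j) * r j ^ (β - 1)) :=
            mul_le_mul (b1 j) b3 p3.le (by positivity)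
        _ ≤ K2 * ((K1 * X ^ (2 * β)) * (X ^ (1 - β) * X ^ (- α j) * r j ^ (β - 1))) :=
            le_mul_of_one_le_left (by positivity) hK2p
        _ = _ := by ring
    · calc (1 + r j ^ (2 * β)) * r j ^ (- α j) ≤ (K1 * X ^ (2 * β)) * (K2 * X ^ (- α j)) :=
            mul_le_mul (b1 j) (b2 j hjk) p3.le (by positivity)
        _ = _ := by ring
  have pk : 0 < 1 + r k ^ (2 * β) := by have := Real.rpow_pos_of_pos (hr k) (2 * β); linarith
  rw [← mul_div_assoc, le_div_iff₀ pk]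
  have p4 : 0 < r k ^ (β - 1) := Real.rpow_pos_of_pos (hr k) _
  have hsumexp : ∏ j, X ^ (2 * β - α j) = X ^ (∑ j, (2 * β - α j)) := by
    rw [Real.rpow_sum_of_pos hX0]
  have hfin : X ^ (∑ j, (2 * β - α j)) * X ^ (1 - β) * X ^ (2 * β) ≤ 1 := by
    rw [← Real.rpow_add hX0, ← Real.rpow_add hX0]
    refine Real.rpow_le_one_of_one_le_of_nonpos hX1 ?_
    rw [Finset.sum_sub_distrib]
    simp
    linarith
  calc (∏ j, ((1 + r j ^ (2 * β)) * r j ^ (- α j))) * (1 + r k ^ (2 * β))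
      ≤ (∏ j, ((K1 * K2) * X ^ (2 * β - α j) * (if j = k then X ^ (1 - β) * r k ^ (β - 1) else 1))) *
        (K1 * X ^ (2 * β)) := by
        refine mul_le_mul (Finset.prod_le_prod (fun j _ => ?_) (fun j _ => b4 j)) (b1 k) pk.le ?_
        · have := hr j
          positivity
        · refine Finset.prod_nonneg fun j _ => ?_
          have := hr k
          split_ifs <;> positivity
    _ = (K1 * (K1 * K2) ^ q * r k ^ (β - 1)) * (X ^ (∑ j, (2 * β - α j)) * X ^ (1 - β) * X ^ (2 * β)) := by
        rw [Finset.prod_mul_distrib, Finset.prod_mul_distrib, hsumexp]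
        simp
        ring
    _ ≤ (K1 * (K1 * K2) ^ q * r k ^ (β - 1)) * 1 := mul_le_mul_of_nonneg_left hfin (by positivity)
    _ = _ := by ring

/-- Nevanlinna's criterion for entire functions: if `f` is a nonconstant entire function and
`a 1, …, a q` are distinct totally ramified values of `f` with multiplicities `m k ≥ 2`
(every preimage of `a k` is a zero of all derivatives `f^(j)` for `1 ≤ j ≤ m k - 1`),
then `∑ (1 - 1/m k) ≤ 1`. -/
theorem nevanlinna_sum_totally_ramified_le_one
    (f : ℂ → ℂ) (hf : Differentiable ℂ f)
    (hnc : ∃ z w : ℂ, f z ≠ f w)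
    (q : ℕ) (a : Fin q → ℂ) (ha : Function.Injective a)
    (m : Fin q → ℕ) (hm : ∀ k, 2 ≤ m k)
    (hram : ∀ k, ∀ z : ℂ, f z = a k →
      ∀ j : ℕ, 1 ≤ j → j ≤ m k - 1 → iteratedDeriv j f z = 0) :
    ∑ k, (1 - 1 / (m k : ℝ)) ≤ 1 := by
  by_contra! hS
  set S : ℝ := ∑ k, (1 - 1 / (m k : ℝ)) with hSdef
  have hq : 0 < q := by
    rcases Nat.eq_zero_or_pos q with rfl | h
    · simp [hSdef] at hS
      linarith
    · exact h
  have : Nonempty (Fin q) := ⟨⟨0, hq⟩⟩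
  have hmk : ∀ k, 0 < 1 - 1 / (m k : ℝ) ∧ 1 - 1 / (m k : ℝ) < 1 := by
    intro k
    have h2 : (2:ℝ) ≤ m k := by exact_mod_cast hm k
    have h3 : 1 / (m k : ℝ) ≤ 1 / 2 := one_div_le_one_div_of_le two_pos h2
    have h4 : 0 < 1 / (m k : ℝ) := by positivity
    constructor <;> linarith
  set lam : ℝ := (1 + S) / (2 * S) with hlam
  have hlam0 : 0 < lam := by positivity
  have hlam1 : lam < 1 := by rw [hlam, div_lt_one (by linarith)]; linarith
  have hlamS : 1 < lam * S := by
    have : lam * S = (1 + S) / 2 := by rw [hlam]; field_simp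
    rw [this]; linarith
  set α : Fin q → ℝ := fun k => lam * (1 - 1 / (m k : ℝ)) with hαdef
  have hα0 : ∀ k, 0 < α k := fun k => mul_pos hlam0 (hmk k).1
  have hα1 : ∀ k, α k < 1 - 1 / (m k : ℝ) := fun k => mul_lt_of_lt_one_left (hmk k).1 hlam1
  have hαS : 1 < ∑ k, α k := by rw [hαdef, ← Finset.mul_sum]; exact hlamS
  obtain ⟨β, hβ, hαβ, hβs⟩ : ∃ β : ℝ, 0 < β ∧ (∀ k, α k + β ≤ 1) ∧
      β * (2 * q + 1) ≤ ∑ k, α k - 1 := by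
    obtain ⟨k0, hk0⟩ := Finite.exists_min (fun k => 1 - α k)
    refine ⟨min (1 - α k0) ((∑ k, α k - 1) / (2 * q + 1)), lt_min ?_ ?_, ?_, ?_⟩
    · linarith [hα1 k0, (hmk k0).2]
    · exact div_pos (by linarith) (by positivity)
    · intro k
      have h1 := min_le_left (1 - α k0) ((∑ k, α k - 1) / (2 * q + 1))
      have h2 := hk0 k
      linarith
    · have h1 := min_le_right (1 - α k0) ((∑ k, α k - 1) / (2 * q + 1))
      exact (le_div_iff₀ (by positivity)).1 h1
  obtain ⟨C, hC, hbound⟩ := nev_bound a ha hq α β hα0 hβ hαβ hβs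
  -- the pulled back metric
  set ρ : ℂ → ℝ := fun z => (∏ j, ((1 + ‖f z - a j‖ ^ (2 * β)) * ‖f z - a j‖ ^ (- α j))) *
    ‖deriv f z‖ with hρ
  have hdf : Continuous (deriv f) := (hf.contDiff (n := 1)).continuous_deriv le_rfl
  have hcρ : Continuous ρ := by
    rw [continuous_iff_continuousAt]
    intro z0
    have hfac : ∀ j, f z0 ≠ a j → ContinuousAt
        (fun z => (1 + ‖f z - a j‖ ^ (2 * β)) * ‖f z - a j‖ ^ (- α j)) z0 := by
      intro j hj
      have h1 : ContinuousAt (fun z => ‖f z - a j‖) z0 := by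
        have := hf.continuous
        fun_prop
      have h2 : ‖f z0 - a j‖ ≠ 0 := norm_ne_zero_iff.2 (sub_ne_zero.2 hj)
      exact (continuousAt_const.add (h1.rpow_const (Or.inl h2))).mul (h1.rpow_const (Or.inl h2))
    by_cases hz : ∃ k, f z0 = a k
    · obtain ⟨k, hk⟩ := hz
      have e : ρ = fun z => ((‖f z - a k‖ ^ (- α k) * ‖deriv f z‖) * (1 + ‖f z - a k‖ ^ (2 * β))) *
          ∏ j ∈ univ.erase k, ((1 + ‖f z - a j‖ ^ (2 * β)) * ‖f z - a j‖ ^ (- α j)) := by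
        funext z
        simp only [hρ]
        rw [← Finset.mul_prod_erase _ _ (Finset.mem_univ k)]
        ring
      rw [e]
      refine ContinuousAt.mul (ContinuousAt.mul ?_ ?_) ?_
      · have h1 := nev_cont f hf hnc z0 (a k) hk (m k) (hm k) (hram k z0 hk) (α k) (hα0 k) (hα1 k)
        have h2 : ‖f z0 - a k‖ ^ (- α k) * ‖deriv f z0‖ = 0 := by
          rw [hk, sub_self, norm_zero, Real.zero_rpow (neg_ne_zero.2 (hα0 k).ne'), zero_mul]
        have h3 := h1
        rw [← h2] at h3
        exact h3
      · have h1 : ContinuousAt (fun z => ‖f z - a k‖) z0 := by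
          have := hf.continuous
          fun_prop
        exact continuousAt_const.add (h1.rpow_const (Or.inr (by positivity)))
      · refine tendsto_finsetProd _ fun j hj => hfac j ?_
        intro h
        exact (Finset.ne_of_mem_erase hj) (ha (h.symm.trans hk))
    · push Not at hz
      refine ContinuousAt.mul ?_ hdf.continuousAt.norm
      exact tendsto_finsetProd _ fun j _ => hfac j (hz j)
  have hρa : ∀ z k, f z = a k → ρ z = 0 := by
    intro z k hk
    simp only [hρ]
    rw [Finset.prod_eq_zero (Finset.mem_univ k), zero_mul]
    rw [hk, sub_self, norm_zero, Real.zero_rpow (neg_ne_zero.2 (hα0 k).ne'), mul_zero]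
  obtain ⟨p, hp⟩ : ∃ p, deriv f p ≠ 0 := by
    by_contra! h
    obtain ⟨z, w, hzw⟩ := hnc
    exact hzw (is_const_of_deriv_eq_zero hf h z w)
  have hpa : ∀ k, f p ≠ a k := by
    intro k hk
    have := hram k p hk 1 le_rfl (by have := hm k; omega)
    rw [iteratedDeriv_one] at this
    exact hp this
  have hρp : 0 < ρ p := by
    refine mul_pos (Finset.prod_pos fun j _ => ?_) (norm_pos_iff.2 hp)
    have : 0 < ‖f p - a j‖ := norm_pos_iff.2 (sub_ne_zero.2 (hpa j))
    positivity
  -- the main estimate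
  have main : ∀ R : ℝ, ‖p‖ < R → ρ p * (R ^ 2 - ‖p‖ ^ 2) ≤ C * R / β := by
    intro R hR
    have hR0 : 0 < R := lt_of_le_of_lt (norm_nonneg _) hR
    obtain ⟨z0, hz0, hmax⟩ := (isCompact_closedBall (0:ℂ) R).exists_isMaxOn
      ⟨p, by simpa using hR.le⟩
      (f := fun z => ρ z * (R ^ 2 - ‖z‖ ^ 2)) (by fun_prop)
    have hGp : 0 < ρ p * (R ^ 2 - ‖p‖ ^ 2) := by
      refine mul_pos hρp ?_
      have := norm_nonneg p
      nlinarith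
    have hle : ρ p * (R ^ 2 - ‖p‖ ^ 2) ≤ ρ z0 * (R ^ 2 - ‖z0‖ ^ 2) :=
      hmax (by simpa using hR.le)
    have hG0 := hGp.trans_le hle
    have hz0' : ‖z0‖ ≤ R := by simpa using hz0
    have hz0R : ‖z0‖ < R := by
      refine lt_of_le_of_ne hz0' fun h => ?_
      rw [h, sub_self, mul_zero] at hG0
      exact lt_irrefl _ hG0
    have hfz : ∀ k, f z0 ≠ a k := by
      intro k hk
      rw [hρa z0 k hk, zero_mul] at hG0
      exact lt_irrefl _ hG0
    have hfd : deriv f z0 ≠ 0 := by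
      intro h
      simp [hρ, h] at hG0
    refine hle.trans ?_
    choose g hgan hgn hgd using fun j => nev_branch f hf z0 (a j) (hfz j) β
    choose b hban hbn hbd using fun j => nev_branch f hf z0 (a j) (hfz j) (- α j)
    set P : ℂ → ℂ := fun z => deriv f z * ∏ j, b j z with hPdef
    have hPan : AnalyticAt ℂ P z0 :=
      (hf.analyticAt z0).deriv.mul (Finset.analyticAt_fun_prod _ fun j _ => hban j)
    have hP0 : P z0 ≠ 0 := by
      refine mul_ne_zero hfd (Finset.prod_ne_zero_iff.2 fun j _ => ?_)
      rw [← norm_pos_iff, hbn]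
      have : 0 < ‖f z0 - a j‖ := norm_pos_iff.2 (sub_ne_zero.2 (hfz j))
      positivity
    have hg2 : ∀ j z, ‖g j z‖ ^ 2 = ‖f z - a j‖ ^ (2 * β) := by
      intro j z
      rw [hgn, ← Real.rpow_natCast, ← Real.rpow_mul (norm_nonneg _)]
      congr 1; push_cast; ring
    have hG : ∀ z, ‖P z‖ * (∏ j, (1 + ‖g j z‖ ^ 2)) * (R ^ 2 - ‖z‖ ^ 2) =
        ρ z * (R ^ 2 - ‖z‖ ^ 2) := by
      intro z
      simp only [hPdef, hρ, norm_mul, norm_prod, hg2, hbn, Finset.prod_mul_distrib]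
      ring
    have hL := nev_local_max z0 R hz0R P hPan hP0 g hgan (by
      have : ∀ᶠ z in 𝓝 z0, ‖z‖ < R := continuous_norm.continuousAt.eventually_lt_const hz0R
      filter_upwards [this] with z hz
      rw [hG, hG]
      exact hmax (by simpa using hz.le))
    obtain ⟨k, hk⟩ := hbound (f z0) hfz
    have hLk := hL k
    rw [hgd, hg2, abs_of_pos hβ] at hLk
    have hd0 : 0 < R ^ 2 - ‖z0‖ ^ 2 := by
      have := norm_nonneg z0
      nlinarith
    have hr : 0 < ‖f z0 - a k‖ := norm_pos_iff.2 (sub_ne_zero.2 (hfz k))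
    have h1 : 0 < 1 + ‖f z0 - a k‖ ^ (2 * β) := by positivity
    calc ρ z0 * (R ^ 2 - ‖z0‖ ^ 2)
        ≤ C * (‖f z0 - a k‖ ^ (β - 1) / (1 + ‖f z0 - a k‖ ^ (2 * β))) * ‖deriv f z0‖ *
          (R ^ 2 - ‖z0‖ ^ 2) := by
          simp only [hρ]
          gcongr
      _ = C / β * ((β * ‖f z0 - a k‖ ^ (β - 1) * ‖deriv f z0‖ * (R ^ 2 - ‖z0‖ ^ 2)) /
          (1 + ‖f z0 - a k‖ ^ (2 * β))) := by field_simp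
      _ ≤ C / β * R := by
          refine mul_le_mul_of_nonneg_left ?_ (by positivity)
          rw [div_le_iff₀ h1]; exact hLk
      _ = C * R / β := by ring
  -- let `R` be large
  set D : ℝ := C / β / ρ p with hD
  have hD0 : 0 < D := by positivity
  have hfinal := main (‖p‖ + D + 1) (by linarith)
  have h2 : C * (‖p‖ + D + 1) / β = ρ p * (D * (‖p‖ + D + 1)) := by
    rw [hD]; field_simp
  rw [h2] at hfinal
  have h3 := le_of_mul_le_mul_left hfinal hρp
  have := norm_nonneg p
  nlinarith [mul_nonneg this hD0.le]
end

section
/- A nonconstant entire function f : ℂ → ℂ has at most two finite totally ramified values: the set { a ∈ ℂ : every z with f(z) = a satisfies f'(z) = 0 } has at most 2 elements. (This is the entire-function instance of the consequence of Theorem 2.1 that a parabolic surface has at most four totally ramified values, since for entire functions ∞ is omitted.) -/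
open Filter Topology

lemma tr_disc_identity (z w : ℂ) (h : 1 - (starRingEnd ℂ) w * z ≠ 0) :
    (1 - ‖z‖^2) * (1 - ‖w‖^2) =
      ‖1 - (starRingEnd ℂ) w * z‖^2 * (1 - ‖(z - w) / (1 - (starRingEnd ℂ) w * z)‖^2) := by
  have h' : ‖1 - (starRingEnd ℂ) w * z‖ ≠ 0 := norm_ne_zero_iff.mpr h
  rw [norm_div, div_pow, mul_sub (‖_‖^2), mul_one (‖_‖^2), mul_div_cancel₀ _ (pow_ne_zero 2 h')]
  simp only [Complex.sq_norm, Complex.normSq_apply]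
  simp
  ring

lemma tr_key_freq (K : ℂ → ℂ) (z0 : ℂ) (hz0 : ‖z0‖ < 1) (F e : ℂ → ℝ)
    (hK : ∀ᶠ z in 𝓝 z0, DifferentiableAt ℂ K z) (hK0 : K z0 ≠ 0)
    (he : ∀ᶠ z in 𝓝 z0, 0 ≤ e z)
    (hF : ∀ᶠ z in 𝓝 z0, (1 - ‖z‖^2)^2 * ‖K z‖ * (1 + e z) ≤ F z)
    (hF0 : F z0 = (1 - ‖z0‖^2)^2 * ‖K z0‖)
    (hmax : ∀ᶠ z in 𝓝 z0, F z ≤ F z0) :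
    ∃ᶠ z in 𝓝[≠] z0,
      (1 + e z) * (1 - ‖(z - z0) / (1 - (starRingEnd ℂ) z0 * z)‖^2)^2 ≤ 1 := by
  intro hcon
  have hs : (0:ℝ) < 1 - ‖z0‖^2 := by nlinarith [norm_nonneg z0]
  have hc0 : 1 - (starRingEnd ℂ) z0 * z0 = ((1 - ‖z0‖^2 : ℝ) : ℂ) := by
    rw [Complex.conj_mul']; push_cast; rfl
  have hne : ∀ᶠ z in 𝓝 z0, 1 - (starRingEnd ℂ) z0 * z ≠ 0 := by
    have : ContinuousAt (fun z => 1 - (starRingEnd ℂ) z0 * z) z0 := by fun_prop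
    apply this.eventually_ne
    rw [hc0]; exact_mod_cast hs.ne'
  rw [eventually_nhdsWithin_iff] at hcon
  obtain ⟨ε, hε, hall⟩ := Metric.eventually_nhds_iff.mp
    (hK.and (he.and (hF.and (hmax.and (hne.and hcon)))))
  set H : ℂ → ℂ := fun z => K z * (1 - (starRingEnd ℂ) z0 * z)^4 with hH
  have hHd : DiffContOnCl ℂ H (Metric.ball z0 (ε/2)) := by
    apply DifferentiableOn.diffContOnCl
    rw [closure_ball _ (by positivity)]
    intro z hz
    have hz' : dist z z0 < ε := lt_of_le_of_lt hz (by linarith)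
    have := (hall hz').1
    apply DifferentiableAt.differentiableWithinAt
    simp only [hH]
    fun_prop
  obtain ⟨z, hz, hzmax⟩ := Complex.exists_mem_frontier_isMaxOn_norm
    (Metric.isBounded_ball) ⟨z0, Metric.mem_ball_self (by positivity : 0 < ε/2)⟩ hHd
  rw [frontier_ball _ (by positivity)] at hz
  have hzd : dist z z0 = ε/2 := hz
  have hmx : ‖H z0‖ ≤ ‖H z‖ := hzmax (subset_closure (Metric.mem_ball_self (by positivity)))
  obtain ⟨-, h2, h3, h4, h5, h6⟩ := hall (show dist z z0 < ε by linarith)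
  have hzne : z ≠ z0 := by
    rintro rfl; simp at hzd; linarith
  apply h6 hzne
  have hid := tr_disc_identity z z0 h5
  set P := ‖(z - z0) / (1 - (starRingEnd ℂ) z0 * z)‖^2
  have hH0 : ‖H z0‖ = (1 - ‖z0‖^2)^4 * ‖K z0‖ := by
    simp only [hH, hc0, norm_mul, norm_pow, Complex.norm_real, Real.norm_eq_abs, abs_of_pos hs]
    ring
  have hH0pos : 0 < ‖H z0‖ := by
    rw [hH0]; have := norm_pos_iff.mpr hK0; positivity
  have hHz : ‖H z‖ = ‖1 - (starRingEnd ℂ) z0 * z‖^4 * ‖K z‖ := by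
    simp only [hH, norm_mul, norm_pow]; ring
  have hineq := h3.trans h4
  rw [hF0] at hineq
  have h7 : ‖H z‖ * ((1 + e z) * (1 - P)^2) ≤ ‖H z0‖ := by
    calc ‖H z‖ * ((1 + e z) * (1 - P)^2)
        = (‖1 - (starRingEnd ℂ) z0 * z‖^2 * (1 - P))^2 * ‖K z‖ * (1 + e z) := by rw [hHz]; ring
      _ = (1 - ‖z0‖^2)^2 * ((1 - ‖z‖^2)^2 * ‖K z‖ * (1 + e z)) := by rw [← hid]; ring
      _ ≤ (1 - ‖z0‖^2)^2 * ((1 - ‖z0‖^2)^2 * ‖K z0‖) := by gcongr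
      _ = ‖H z0‖ := by rw [hH0]; ring
  have h8 : 0 ≤ (1 + e z) * (1 - P)^2 := by positivity
  nlinarith [mul_le_mul_of_nonneg_right hmx h8]

lemma tr_moebius_tendsto (z0 : ℂ) (hz0 : ‖z0‖ < 1) :
    Tendsto (fun z => ‖(z - z0) / (1 - (starRingEnd ℂ) z0 * z)‖^2) (𝓝[≠] z0) (𝓝 0) ∧
    Tendsto (fun z => ‖(z - z0) / (1 - (starRingEnd ℂ) z0 * z)‖^2 / ‖z - z0‖^2) (𝓝[≠] z0)
      (𝓝 (1 / (1 - ‖z0‖^2)^2)) := by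
  have hs : (0:ℝ) < 1 - ‖z0‖^2 := by nlinarith [norm_nonneg z0]
  have hc0 : 1 - (starRingEnd ℂ) z0 * z0 = ((1 - ‖z0‖^2 : ℝ) : ℂ) := by
    rw [Complex.conj_mul']; push_cast; rfl
  have hne : 1 - (starRingEnd ℂ) z0 * z0 ≠ 0 := by rw [hc0]; exact_mod_cast hs.ne'
  constructor
  · have : ContinuousAt (fun z => ‖(z - z0) / (1 - (starRingEnd ℂ) z0 * z)‖^2) z0 := by
      fun_prop (disch := exact hne)
    have h := this.tendsto.mono_left (nhdsWithin_le_nhds (s := {z0}ᶜ))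
    simpa using h
  · have : ContinuousAt (fun z => 1 / ‖1 - (starRingEnd ℂ) z0 * z‖^2) z0 := by
      have : ‖1 - (starRingEnd ℂ) z0 * z0‖^2 ≠ 0 := by simpa using hne
      fun_prop (disch := exact this)
    have h := this.tendsto.mono_left (nhdsWithin_le_nhds (s := {z0}ᶜ))
    rw [hc0, Complex.norm_real, Real.norm_eq_abs, sq_abs] at h
    refine h.congr' ?_
    filter_upwards [self_mem_nhdsWithin] with z hz
    have : ‖z - z0‖ ≠ 0 := by simpa [sub_eq_zero] using hz
    rw [norm_div, div_pow]
    field_simp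

lemma tr_smooth_case (z0 : ℂ) (hz0 : ‖z0‖ < 1) (t : ℂ → ℂ) (t' : ℂ) (ht : HasDerivAt t t' z0)
    (ht0 : t z0 = 1) (x : ℝ) (hx : 0 < x)
    (h : ∃ᶠ z in 𝓝[≠] z0, (1 + x * ‖t z - 1‖^2 / ‖1 + x * t z‖^2) *
      (1 - ‖(z - z0) / (1 - (starRingEnd ℂ) z0 * z)‖^2)^2 ≤ 1) :
    x * ‖t'‖^2 / (1 + x)^2 ≤ 2 * (1 / (1 - ‖z0‖^2)^2) := by
  obtain ⟨hP, hQ⟩ := tr_moebius_tendsto z0 hz0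
  have hslope := (hasDerivAt_iff_tendsto_slope.mp ht).norm
  have htc : Tendsto t (𝓝[≠] z0) (𝓝 1) := by
    rw [← ht0]; exact ht.continuousAt.tendsto.mono_left nhdsWithin_le_nhds
  have hd : Tendsto (fun z => ‖1 + x * t z‖^2) (𝓝[≠] z0) (𝓝 ((1+x)^2)) := by
    have := (((htc.const_mul (x:ℂ)).const_add 1).norm).pow 2
    convert this using 2
    rw [mul_one, show (1 + (x:ℂ)) = ((1 + x : ℝ) : ℂ) by push_cast; rfl, Complex.norm_real,
      Real.norm_eq_abs, sq_abs]
  have hE : Tendsto (fun z => x * ‖slope t z0 z‖^2 / ‖1 + x * t z‖^2) (𝓝[≠] z0)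
      (𝓝 (x * ‖t'‖^2 / (1+x)^2)) := ((hslope.pow 2).const_mul x).div hd (by positivity)
  have hL := ((hE.mul ((hP.const_sub 1).pow 2)).sub (hQ.const_mul 2)).add (hP.mul hQ)
  have := le_of_tendsto_of_frequently hL (b := 0) ?_
  · linarith
  refine (h.and_eventually self_mem_nhdsWithin).mono ?_
  rintro z ⟨h1, hz⟩
  have hzn : 0 < ‖z - z0‖ := by
    rw [norm_pos_iff, sub_ne_zero]; exact hz
  have hsl : ‖slope t z0 z‖^2 = ‖t z - 1‖^2 / ‖z - z0‖^2 := by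
    rw [slope_def_field, ht0, norm_div, div_pow]
  rw [hsl]
  set P := ‖(z - z0) / (1 - (starRingEnd ℂ) z0 * z)‖^2
  have : x * (‖t z - 1‖^2 / ‖z - z0‖^2) / ‖1 + x * t z‖^2 * (1 - P)^2 - 2 * (P / ‖z - z0‖^2)
     + P * (P / ‖z-z0‖^2) = ((1 + x * ‖t z - 1‖^2 / ‖1 + x * t z‖^2) * (1 - P)^2 - 1) / ‖z - z0‖^2 := by
    field_simp
    ring
  rw [this]
  apply div_nonpos_of_nonpos_of_nonneg <;> [linarith; positivity]

lemma tr_sing_case (z0 : ℂ) (hz0 : ‖z0‖ < 1) (g h : ℂ → ℂ) (hh : ContinuousAt h z0)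
    (hh0 : h z0 ≠ 0) (hg : ∀ᶠ z in 𝓝 z0, g z = (z - z0)^2 * h z) (e : ℂ → ℝ)
    (he0 : ∀ z, 0 ≤ e z) (he : ∀ z, e z ^ 4 = ‖g z‖)
    (hf : ∃ᶠ z in 𝓝[≠] z0, (1 + e z) *
      (1 - ‖(z - z0) / (1 - (starRingEnd ℂ) z0 * z)‖^2)^2 ≤ 1) : False := by
  obtain ⟨hP, hQ⟩ := tr_moebius_tendsto z0 hz0
  have hhn := hh.norm.tendsto.mono_left (nhdsWithin_le_nhds (s := {z0}ᶜ))
  have hL := (hhn.mul ((hP.const_sub 1).pow 8)).sub (((hP.pow 3).mul hQ).const_mul 16)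
  have := le_of_tendsto_of_frequently hL (b := 0) ?_
  · have := norm_pos_iff.mpr hh0
    norm_num at *
    exact hh0 ‹_›
  refine ((hf.and_eventually self_mem_nhdsWithin).and_eventually
    (hg.filter_mono nhdsWithin_le_nhds)).mono ?_
  rintro z ⟨⟨h1, hz⟩, h2⟩
  have hzn : 0 < ‖z - z0‖ := by
    rw [norm_pos_iff, sub_ne_zero]; exact hz
  set P := ‖(z - z0) / (1 - (starRingEnd ℂ) z0 * z)‖^2 with hPdef
  have hP0 : 0 ≤ P := by positivity
  have h3 : e z * (1 - P)^2 ≤ 2 * P := by nlinarith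
  have h4 : (e z * (1 - P)^2)^4 ≤ (2 * P)^4 := by
    have := he0 z
    gcongr
  have h5 : e z ^ 4 = ‖z - z0‖^2 * ‖h z‖ := by rw [he, h2, norm_mul, norm_pow]
  have h6 : ‖z - z0‖^2 * (‖h z‖ * (1-P)^8) ≤ 16 * P^4 := by
    calc _ = (e z * (1 - P)^2)^4 := by rw [mul_pow, h5]; ring
      _ ≤ _ := h4
      _ = _ := by ring
  have h7 : ‖h z‖ * (1-P)^8 ≤ 16 * P^4 / ‖z - z0‖^2 := by
    rw [le_div_iff₀ (by positivity)]; linarith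
  have h8 : 16 * (P^3 * (P / ‖z - z0‖^2)) = 16 * P^4 / ‖z - z0‖^2 := by ring
  linarith

lemma tr_order (f : ℂ → ℂ) (hf : Differentiable ℂ f) (hnc : ∃ z w : ℂ, f z ≠ f w) (z0 : ℂ) :
    ∃ n : ℕ, analyticOrderAt (deriv f) z0 = n ∧ analyticOrderAt (fun z => f z - f z0) z0 = n + 1 := by
  have h1 := (hf.analyticAt z0).analyticOrderAt_deriv_add_one
  have h2 : analyticOrderAt (deriv f) z0 ≠ ⊤ := by
    intro h
    rw [h, top_add, eq_comm, analyticOrderAt_eq_top] at h1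
    have h3 := AnalyticOnNhd.eq_of_eventuallyEq (f := f) (g := fun _ => f z0) (z₀ := z0)
      (fun z _ => hf.analyticAt z) (fun z _ => analyticAt_const)
      (h1.mono fun z hz => sub_eq_zero.mp hz)
    obtain ⟨z, w, hzw⟩ := hnc
    exact hzw (by rw [h3])
  obtain ⟨n, hn⟩ := ENat.ne_top_iff_exists.mp h2
  exact ⟨n, hn.symm, by rw [← h1, hn]⟩

lemma tr_order_prod (f : ℂ → ℂ) (hf : Differentiable ℂ f) (z0 a b c : ℂ) (hab : a ≠ b)
    (hac : a ≠ c) (h : f z0 = a) :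
    analyticOrderAt (fun z => (f z - a) * (f z - b) * (f z - c)) z0 =
      analyticOrderAt (fun z => f z - f z0) z0 := by
  have ha : ∀ a, AnalyticAt ℂ (fun z => f z - a) z0 := fun a =>
    (hf.analyticAt z0).sub analyticAt_const
  have e1 := analyticOrderAt_mul ((ha a).mul (ha b)) (ha c)
  have e2 := analyticOrderAt_mul (ha a) (ha b)
  have e3 : analyticOrderAt (fun z => f z - b) z0 = 0 :=
    (ha b).analyticOrderAt_eq_zero.mpr (by rw [h]; exact sub_ne_zero.mpr hab)
  have e4 : analyticOrderAt (fun z => f z - c) z0 = 0 :=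
    (ha c).analyticOrderAt_eq_zero.mpr (by rw [h]; exact sub_ne_zero.mpr hac)
  rw [e2, e3, e4, add_zero, add_zero] at e1
  rw [h]
  exact e1

lemma tr_order_le (f : ℂ → ℂ) (hf : Differentiable ℂ f) (hnc : ∃ z w : ℂ, f z ≠ f w)
    (a b c : ℂ) (hab : a ≠ b) (hac : a ≠ c) (ha : ∀ z, f z = a → deriv f z = 0) (z0 : ℂ)
    (h : f z0 = a) :
    ∃ n : ℕ, analyticOrderAt (fun z => (f z - a) * (f z - b) * (f z - c)) z0 = n ∧
      (n : ℕ∞) ≤ analyticOrderAt (fun z => deriv f z ^ 2) z0 := by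
  obtain ⟨n, h1, h2⟩ := tr_order f hf hnc z0
  have hd : AnalyticAt ℂ (deriv f) z0 := (hf.analyticAt z0).deriv
  refine ⟨n + 1, by rw [tr_order_prod f hf z0 a b c hab hac h, h2]; norm_cast, ?_⟩
  have := analyticOrderAt_pow hd 2
  change analyticOrderAt (fun z => deriv f z ^ 2) z0 = _ at this
  rw [this, h1]
  have hn : n ≠ 0 := by
    rintro rfl
    exact (hd.analyticOrderAt_eq_zero.mp (by simpa using h1)) (ha z0 h)
  rw [nsmul_eq_mul]
  norm_cast
  omega

lemma tr_exists_G (f : ℂ → ℂ) (hf : Differentiable ℂ f) (hnc : ∃ z w : ℂ, f z ≠ f w)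
    (a b c : ℂ) (hab : a ≠ b) (hac : a ≠ c) (hbc : b ≠ c)
    (ha : ∀ z, f z = a → deriv f z = 0) (hb : ∀ z, f z = b → deriv f z = 0)
    (hc : ∀ z, f z = c → deriv f z = 0) :
    ∃ G : ℂ → ℂ, Differentiable ℂ G ∧
      ∀ z, deriv f z ^ 2 = G z * ((f z - a) * (f z - b) * (f z - c)) := by
  set A : ℂ → ℂ := fun z => deriv f z ^ 2 with hA
  set Q : ℂ → ℂ := fun z => (f z - a) * (f z - b) * (f z - c) with hQ
  have hfa : ∀ z, AnalyticAt ℂ f z := fun z => hf.analyticAt z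
  have hAa : ∀ z, AnalyticAt ℂ A z := fun z => (hfa z).deriv.pow 2
  have hQa : ∀ z, AnalyticAt ℂ Q z := fun z =>
    (((hfa z).sub analyticAt_const).mul ((hfa z).sub analyticAt_const)).mul
      ((hfa z).sub analyticAt_const)
  have hord : ∀ z0, ∃ n : ℕ, analyticOrderAt Q z0 = n ∧ (n : ℕ∞) ≤ analyticOrderAt A z0 := by
    intro z0
    by_cases h1 : f z0 = a
    · exact tr_order_le f hf hnc a b c hab hac ha z0 h1
    by_cases h2 : f z0 = b
    · convert tr_order_le f hf hnc b a c hab.symm hbc hb z0 h2 using 5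
      simp only [hQ]; ext z; ring
    by_cases h3 : f z0 = c
    · convert tr_order_le f hf hnc c a b hac.symm hbc.symm hc z0 h3 using 5
      simp only [hQ]; ext z; ring
    refine ⟨0, ?_, by simp⟩
    simp only [Nat.cast_zero]
    rw [(hQa z0).analyticOrderAt_eq_zero]
    simp [hQ, sub_eq_zero, h1, h2, h3]
  have hM : MeromorphicOn (A / Q) Set.univ := fun z _ =>
    (hAa z).meromorphicAt.div (hQa z).meromorphicAt
  have hGa : ∀ z, AnalyticAt ℂ (toMeromorphicNFOn (A / Q) Set.univ) z := by
    intro z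
    rw [← (meromorphicNFOn_toMeromorphicNFOn (A / Q) Set.univ
      (Set.mem_univ z)).meromorphicOrderAt_nonneg_iff_analyticAt,
      meromorphicOrderAt_toMeromorphicNFOn hM (Set.mem_univ z),
      meromorphicOrderAt_div (hAa z).meromorphicAt (hQa z).meromorphicAt,
      (hAa z).meromorphicOrderAt_eq, (hQa z).meromorphicOrderAt_eq]
    obtain ⟨n, h1, h2⟩ := hord z
    rw [h1]
    cases hh : analyticOrderAt A z with
    | top => simp
    | coe m =>
      rw [hh] at h2
      have : n ≤ m := by exact_mod_cast h2
      simp only [ENat.map_natCast]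
      norm_cast
      omega
  refine ⟨toMeromorphicNFOn (A / Q) Set.univ, fun z => (hGa z).differentiableAt, fun z => ?_⟩
  have h1 := hM.toMeromorphicNFOn_eq_self_on_nhdsNE (Set.mem_univ z)
  have h2 : ∀ᶠ w in 𝓝[≠] z, Q w ≠ 0 := by
    rcases (hQa z).eventually_eq_zero_or_eventually_ne_zero with h | h
    · obtain ⟨n, h3, -⟩ := hord z
      rw [analyticOrderAt_eq_top.mpr h] at h3
      simp at h3
    · exact h
  have h3 : A =ᶠ[𝓝[≠] z] fun w => toMeromorphicNFOn (A / Q) Set.univ w * Q w := by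
    filter_upwards [h1, h2] with w hw1 hw2
    rw [hw1, Pi.div_apply, div_mul_cancel₀ _ hw2]
  have h4 := ((hAa z).continuousAt.eventuallyEq_nhds_iff_eventuallyEq_nhdsNE
    ((hGa z).continuousAt.mul (hQa z).continuousAt)).mp h3
  exact h4.eq_of_nhds

lemma tr_order_two (f : ℂ → ℂ) (hf : Differentiable ℂ f) (hnc : ∃ z w : ℂ, f z ≠ f w)
    (a b c : ℂ) (hab : a ≠ b) (hac : a ≠ c) (G : ℂ → ℂ) (hG : Differentiable ℂ G)
    (hGe : ∀ z, deriv f z ^ 2 = G z * ((f z - a) * (f z - b) * (f z - c)))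
    (z0 : ℂ) (h : f z0 = a) (hG0 : G z0 ≠ 0) :
    ∃ g : ℂ → ℂ, ContinuousAt g z0 ∧ g z0 ≠ 0 ∧ ∀ᶠ z in 𝓝 z0, f z - a = (z - z0)^2 * g z := by
  obtain ⟨n, h1, h2⟩ := tr_order f hf hnc z0
  have hfa := hf.analyticAt z0
  have h3 := analyticOrderAt_pow hfa.deriv 2
  have h4 := tr_order_prod f hf z0 a b c hab hac h
  have h5 := analyticOrderAt_mul (g := fun z => (f z - a) * (f z - b) * (f z - c)) (hG.analyticAt z0)
    (((hfa.sub analyticAt_const).mul (hfa.sub analyticAt_const)).mul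
      (hfa.sub analyticAt_const))
  have h6 : deriv f ^ 2 = G * fun z => (f z - a) * (f z - b) * (f z - c) := funext hGe
  rw [← h6, h3, h4, h2, h1, (hG.analyticAt z0).analyticOrderAt_eq_zero.mpr hG0, nsmul_eq_mul] at h5
  have h7 : n = 1 := by
    norm_cast at h5; omega
  subst h7
  have h8 : AnalyticAt ℂ (fun z => f z - f z0) z0 := hfa.sub analyticAt_const
  obtain ⟨g, hg1, hg2, hg3⟩ := (h8.analyticOrderAt_eq_natCast (n := 2)).mp (by rw [h2]; rfl)
  refine ⟨g, hg1.continuousAt, hg2, ?_⟩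
  rw [h] at hg3
  simpa using hg3

/-- fourth root of the norm -/
noncomputable def trX (w : ℂ) : ℝ := √(√‖w‖)

lemma trX_nonneg (w : ℂ) : 0 ≤ trX w := Real.sqrt_nonneg _
lemma trX_pow (w : ℂ) : trX w ^ 4 = ‖w‖ := by
  rw [trX, show 4 = 2 * 2 by norm_num, pow_mul, Real.sq_sqrt (Real.sqrt_nonneg _),
    Real.sq_sqrt (norm_nonneg _)]
lemma trX_cont : Continuous trX := by unfold trX; fun_prop
lemma trX_pos {w : ℂ} (h : w ≠ 0) : 0 < trX w := by
  have := norm_pos_iff.mpr h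
  unfold trX; positivity

lemma tr_root (f : ℂ → ℂ) (hf : Differentiable ℂ f) (z0 a : ℂ) (h : f z0 ≠ a) :
    ∃ t : ℂ → ℂ, (∀ᶠ z in 𝓝 z0, DifferentiableAt ℂ t z) ∧ t z0 = 1 ∧
      HasDerivAt t (deriv f z0 / (8 * (f z0 - a))) z0 ∧
      ∀ z, trX (f z - a) = trX (f z0 - a) * ‖t z‖^2 := by
  have h' : f z0 - a ≠ 0 := sub_ne_zero.mpr h
  set r : ℂ → ℂ := fun z => (f z - a) / (f z0 - a) with hr
  have hr0 : r z0 = 1 := div_self h'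
  have hrd : ∀ z, DifferentiableAt ℂ r z := fun z => ((hf z).sub_const a).div_const _
  have hsl : ∀ᶠ z in 𝓝 z0, r z ∈ Complex.slitPlane := by
    apply (hrd z0).continuousAt.eventually_mem
    apply Complex.isOpen_slitPlane.mem_nhds
    rw [hr0]; exact Complex.one_mem_slitPlane
  refine ⟨fun z => r z ^ (((8:ℕ) : ℂ)⁻¹), ?_, ?_, ?_, ?_⟩
  · filter_upwards [hsl] with z hz
    exact (hrd z).cpow_const hz
  · simp [hr0]
  · have h1 : HasDerivAt r (deriv f z0 / (f z0 - a)) z0 :=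
      ((hf z0).hasDerivAt.sub_const a).div_const _
    have h2 := h1.cpow_const (c := (((8:ℕ) : ℂ)⁻¹)) (by rw [hr0]; exact Complex.one_mem_slitPlane)
    convert h2 using 1
    rw [hr0]
    simp
    field_simp
  · intro z
    have h3 : (trX (f z - a))^4 = (trX (f z0 - a) * ‖r z ^ (((8:ℕ) : ℂ)⁻¹)‖^2)^4 := by
      rw [mul_pow, trX_pow, trX_pow, ← pow_mul, ← norm_pow, Complex.cpow_nat_inv_pow _ (by norm_num),
        ← norm_mul, hr]
      simp only
      rw [mul_div_cancel₀ _ h']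
    exact (pow_left_inj₀ (trX_nonneg _) (mul_nonneg (trX_nonneg _) (by positivity))
      (by norm_num)).mp h3

lemma tr_factor_id (x : ℝ) (t : ℂ) :
    (1 + x * ‖t‖^2) * (1 + x) = ‖1 + x * t‖^2 + x * ‖t - 1‖^2 := by
  simp only [Complex.sq_norm, Complex.normSq_apply]
  simp
  ring

lemma tr_factor (f : ℂ → ℂ) (hf : Differentiable ℂ f) (z0 a : ℂ) (h : f z0 ≠ a) :
    ∃ B t : ℂ → ℂ, (∀ᶠ z in 𝓝 z0, DifferentiableAt ℂ B z) ∧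
      ‖B z0‖ = 1 + trX (f z0 - a) ∧ t z0 = 1 ∧
      HasDerivAt t (deriv f z0 / (8 * (f z0 - a))) z0 ∧
      (∀ z, ‖B z‖ ≤ 1 + trX (f z - a)) ∧
      ∀ᶠ z in 𝓝 z0, ‖B z‖ * (1 + trX (f z0 - a) * ‖t z - 1‖^2 / ‖1 + trX (f z0 - a) * t z‖^2) =
        1 + trX (f z - a) := by
  obtain ⟨t, h1, h2, h3, h4⟩ := tr_root f hf z0 a h
  set x := trX (f z0 - a) with hx
  have hx0 : 0 < x := trX_pos (sub_ne_zero.mpr h)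
  have hn : ‖(1 + x : ℂ)‖ = 1 + x := by
    rw [show (1 + (x:ℂ)) = ((1 + x : ℝ) : ℂ) by push_cast; rfl, Complex.norm_real,
      Real.norm_eq_abs, abs_of_pos (by positivity)]
  have hB : ∀ z, ‖(1 + x * t z)^2 / (1 + x : ℂ)‖ = ‖1 + x * t z‖^2 / (1 + x) := by
    intro z; rw [norm_div, norm_pow, hn]
  refine ⟨fun z => (1 + x * t z)^2 / (1 + x : ℂ), t, ?_, ?_, h2, h3, ?_, ?_⟩
  · filter_upwards [h1] with z hz
    fun_prop
  · rw [hB, h2, mul_one, hn]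
    field_simp
  · intro z
    simp only [hB]
    rw [div_le_iff₀ (by positivity), h4, tr_factor_id]
    have : 0 ≤ x * ‖t z - 1‖^2 := by positivity
    linarith
  · have : ∀ᶠ z in 𝓝 z0, 1 + x * t z ≠ 0 := by
      have hc : ContinuousAt (fun z => 1 + x * t z) z0 := by
        have := h3.continuousAt
        fun_prop
      apply hc.eventually_ne
      rw [h2, mul_one, ← norm_pos_iff, hn]; positivity
    filter_upwards [this] with z hz
    have hz' := norm_pos_iff.mpr hz
    simp only [hB]
    have h5 := tr_factor_id x (t z)
    rw [h4]
    field_simp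
    linarith

/-- The Ahlfors-type density on the unit disc. -/
noncomputable def trF (f G : ℂ → ℂ) (a b c z : ℂ) : ℝ :=
  (1 - ‖z‖^2)^2 * ‖G z‖ * ((1 + trX (f z - a)) * (1 + trX (f z - b)) * (1 + trX (f z - c)))

lemma tr_numeric (x y w S η : ℝ) (hx : 0 < x) (hη : 0 < η) (hxy : x ≤ y) (hxw : x ≤ w)
    (hy : η * (1 + y) ≤ y) (hw : η * (1 + w) ≤ w) (hS : 0 ≤ S)
    (h : S * (y^4 * w^4) ≤ 128 * (x^3 * (1 + x)^2)) :
    S * ((1 + x) * (1 + y) * (1 + w)) ≤ 128 / η^8 := by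
  have hy0 : 0 < y := by linarith
  have hw0 : 0 < w := by linarith
  have aux : ∀ y, 0 < y → x ≤ y → η * (1 + y) ≤ y → η^4 * ((1 + y) * (1 + x)^3) ≤ y^4 := by
    intro y hy0 hxy hy
    calc η^4 * ((1 + y) * (1 + x)^3) ≤ η^4 * ((1 + y) * (1 + y)^3) := by gcongr
      _ = (η * (1 + y))^4 := by ring
      _ ≤ y^4 := by gcongr
  have h1 := aux y hy0 hxy hy
  have h2 := aux w hw0 hxw hw
  rw [le_div_iff₀ (by positivity)]
  have h3 : S * ((η^4 * ((1 + y) * (1 + x)^3)) * (η^4 * ((1 + w) * (1 + x)^3))) ≤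
      128 * ((1 + x)^3 * (1 + x)^2) := by
    calc _ ≤ S * (y^4 * w^4) := by gcongr
      _ ≤ _ := h
      _ ≤ _ := by gcongr; linarith
  have h4 : (S * ((1 + x) * (1 + y) * (1 + w)) * η^8) * (1 + x)^5 ≤ 128 * (1 + x)^5 := by
    calc _ = S * ((η^4 * ((1 + y) * (1 + x)^3)) * (η^4 * ((1 + w) * (1 + x)^3))) := by ring
      _ ≤ _ := h3
      _ = _ := by ring
  exact le_of_mul_le_mul_right h4 (by positivity)

lemma tr_local (f : ℂ → ℂ) (hf : Differentiable ℂ f) (hnc : ∃ z w : ℂ, f z ≠ f w)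
    (a b c : ℂ) (hab : a ≠ b) (hac : a ≠ c) (G : ℂ → ℂ) (hG : Differentiable ℂ G)
    (hGe : ∀ z, deriv f z ^ 2 = G z * ((f z - a) * (f z - b) * (f z - c)))
    (z0 : ℂ) (hz0 : ‖z0‖ < 1) (η : ℝ) (hη : 0 < η)
    (hxb : trX (f z0 - a) ≤ trX (f z0 - b)) (hxc : trX (f z0 - a) ≤ trX (f z0 - c))
    (hb : η * (1 + trX (f z0 - b)) ≤ trX (f z0 - b))
    (hc : η * (1 + trX (f z0 - c)) ≤ trX (f z0 - c))
    (hmax : ∀ᶠ z in 𝓝 z0, trF f G a b c z ≤ trF f G a b c z0) :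
    trF f G a b c z0 ≤ 128 / η^8 := by
  by_cases hG0 : G z0 = 0
  · simp only [trF, hG0, norm_zero, mul_zero, zero_mul]; positivity
  have hs : (0:ℝ) < 1 - ‖z0‖^2 := by nlinarith [norm_nonneg z0]
  have hnez : ∀ b, η * (1 + trX (f z0 - b)) ≤ trX (f z0 - b) → f z0 ≠ b := by
    intro b hb h
    have h0 := trX_pow (f z0 - b)
    rw [h, sub_self, norm_zero] at h0
    rw [h, sub_self, pow_eq_zero_iff (by norm_num) |>.mp h0] at hb
    linarith
  obtain ⟨B, tb, hB1, hB2, -, -, hB3, -⟩ := tr_factor f hf z0 b (hnez b hb)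
  obtain ⟨C, tc, hC1, hC2, -, -, hC3, -⟩ := tr_factor f hf z0 c (hnez c hc)
  have hBne : B z0 ≠ 0 := by
    rw [← norm_pos_iff, hB2]; linarith [trX_nonneg (f z0 - b)]
  have hCne : C z0 ≠ 0 := by
    rw [← norm_pos_iff, hC2]; linarith [trX_nonneg (f z0 - c)]
  by_cases hfa : f z0 = a
  · exfalso
    obtain ⟨g, hg1, hg2, hg3⟩ := tr_order_two f hf hnc a b c hab hac G hG hGe z0 hfa hG0
    refine tr_sing_case z0 hz0 (fun z => f z - a) g hg1 hg2 hg3 (fun z => trX (f z - a))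
      (fun z => trX_nonneg _) (fun z => trX_pow _) ?_
    refine tr_key_freq (fun z => G z * (B z * C z)) z0 hz0 (trF f G a b c) _ ?_ ?_ ?_ ?_ ?_ hmax
    · filter_upwards [hB1, hC1] with z h1 h2
      exact (hG z).mul (h1.mul h2)
    · exact mul_ne_zero hG0 (mul_ne_zero hBne hCne)
    · exact Eventually.of_forall fun z => trX_nonneg _
    · refine Eventually.of_forall fun z => ?_
      have h1 := trX_nonneg (f z - a)
      have h2 := trX_nonneg (f z - b)
      calc (1 - ‖z‖^2)^2 * ‖G z * (B z * C z)‖ * (1 + trX (f z - a))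
          = (1 - ‖z‖^2)^2 * ‖G z‖ * ((1 + trX (f z - a)) * ‖B z‖ * ‖C z‖) := by
            rw [norm_mul, norm_mul]; ring
        _ ≤ _ := by
            unfold trF
            gcongr
            · exact hB3 z
            · exact hC3 z
    · have : trX (f z0 - a) = 0 := by
        have h0 := trX_pow (f z0 - a)
        rw [hfa, sub_self, norm_zero] at h0
        rw [hfa, sub_self]
        exact pow_eq_zero_iff (by norm_num) |>.mp h0
      simp only [trF, this, norm_mul, hB2, hC2]
      ring
  · obtain ⟨A, t, hA1, hA2, ht0, ht', hA3, hA4⟩ := tr_factor f hf z0 a hfa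
    have hAne : A z0 ≠ 0 := by
      rw [← norm_pos_iff, hA2]; linarith [trX_nonneg (f z0 - a)]
    have hx0 : 0 < trX (f z0 - a) := trX_pos (sub_ne_zero.mpr hfa)
    have key := tr_smooth_case z0 hz0 t _ ht' ht0 (trX (f z0 - a)) hx0 (by
      refine tr_key_freq (fun z => G z * (A z * B z * C z)) z0 hz0 (trF f G a b c)
        (fun z => trX (f z0 - a) * ‖t z - 1‖^2 / ‖1 + trX (f z0 - a) * t z‖^2) ?_ ?_ ?_ ?_ ?_ hmax
      · filter_upwards [hA1, hB1, hC1] with z h0 h1 h2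
        exact (hG z).mul ((h0.mul h1).mul h2)
      · exact mul_ne_zero hG0 (mul_ne_zero (mul_ne_zero hAne hBne) hCne)
      · exact Eventually.of_forall fun z => by positivity
      · filter_upwards [hA4] with z hz
        have h1 : 0 ≤ 1 + trX (f z - a) := by linarith [trX_nonneg (f z - a)]
        have h2 := trX_nonneg (f z - b)
        unfold trF
        rw [← hz] at h1 ⊢
        rw [norm_mul, norm_mul, norm_mul]
        set e := (1 + trX (f z0 - a) * ‖t z - 1‖^2 / ‖1 + trX (f z0 - a) * t z‖^2)
        calc (1 - ‖z‖^2)^2 * (‖G z‖ * (‖A z‖ * ‖B z‖ * ‖C z‖)) * e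
            = (1 - ‖z‖^2)^2 * ‖G z‖ * ((‖A z‖ * e) * ‖B z‖ * ‖C z‖) := by ring
          _ ≤ _ := by
            gcongr
            · exact hB3 z
            · exact hC3 z
      · simp only [trF, norm_mul, hA2, hB2, hC2]
        ring)
    have hde : ‖deriv f z0‖^2 = ‖G z0‖ * (trX (f z0 - a)^4 * trX (f z0 - b)^4 * trX (f z0 - c)^4) := by
      rw [← norm_pow, hGe, trX_pow, trX_pow, trX_pow, norm_mul, norm_mul, norm_mul]
    rw [norm_div, norm_mul, ← trX_pow (f z0 - a), div_pow, hde] at key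
    unfold trF
    apply tr_numeric _ _ _ _ η hx0 hη hxb hxc hb hc (by positivity)
    generalize trX (f z0 - a) = x at *
    generalize trX (f z0 - b) = y at *
    generalize trX (f z0 - c) = w at *
    generalize 1 - ‖z0‖^2 = s at *
    generalize ‖G z0‖ = g at *
    have e1 : x * (g * (x^4 * y^4 * w^4) / (‖(8:ℂ)‖ * x^4)^2) / (1 + x)^2 =
        (g * (y^4 * w^4)) / (64 * (x^3 * (1 + x)^2)) := by
      norm_num
      field_simp
      norm_num
    rw [e1, mul_one_div, div_le_div_iff₀ (by positivity) (by positivity)] at key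
    linarith

lemma tr_global (f : ℂ → ℂ) (hf : Differentiable ℂ f) (hnc : ∃ z w : ℂ, f z ≠ f w)
    (a b c : ℂ) (hab : a ≠ b) (hac : a ≠ c) (hbc : b ≠ c) (η : ℝ) (hη : 0 < η)
    (hη' : ∀ w, (trX (w - a) ≤ trX (w - b) ∨ trX (w - c) ≤ trX (w - b) →
        η * (1 + trX (w - b)) ≤ trX (w - b)) ∧
      (trX (w - a) ≤ trX (w - c) ∨ trX (w - b) ≤ trX (w - c) →
        η * (1 + trX (w - c)) ≤ trX (w - c)) ∧
      (trX (w - b) ≤ trX (w - a) ∨ trX (w - c) ≤ trX (w - a) →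
        η * (1 + trX (w - a)) ≤ trX (w - a)))
    (G : ℂ → ℂ) (hG : Differentiable ℂ G)
    (hGe : ∀ z, deriv f z ^ 2 = G z * ((f z - a) * (f z - b) * (f z - c))) :
    ‖G 0‖ ≤ 128 / η^8 := by
  have hcont : Continuous (trF f G a b c) := by
    have := hf.continuous
    have := hG.continuous
    have := trX_cont
    unfold trF
    fun_prop
  obtain ⟨z0, hz0, hmax⟩ := (isCompact_closedBall (0:ℂ) 1).exists_isMaxOn
    ⟨0, Metric.mem_closedBall_self zero_le_one⟩ hcont.continuousOn
  have h0 : trF f G a b c 0 ≤ trF f G a b c z0 := hmax (Metric.mem_closedBall_self zero_le_one)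
  have h1 : ‖G 0‖ ≤ trF f G a b c 0 := by
    have ha := trX_nonneg (f 0 - a)
    have hb := trX_nonneg (f 0 - b)
    have hc := trX_nonneg (f 0 - c)
    have h2 : 1 ≤ (1 + trX (f 0 - a)) * (1 + trX (f 0 - b)) * (1 + trX (f 0 - c)) :=
      one_le_mul_of_one_le_of_one_le
        (one_le_mul_of_one_le_of_one_le (by linarith) (by linarith)) (by linarith)
    simp only [trF, norm_zero]
    nlinarith [norm_nonneg (G 0)]
  refine h1.trans (h0.trans ?_)
  have hz1 : ‖z0‖ ≤ 1 := by simpa using hz0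
  rcases hz1.lt_or_eq with hlt | heq
  · have hmax' : ∀ᶠ z in 𝓝 z0, trF f G a b c z ≤ trF f G a b c z0 := by
      have : Metric.closedBall (0:ℂ) 1 ∈ 𝓝 z0 :=
        Filter.mem_of_superset (Metric.isOpen_ball.mem_nhds (by simpa using hlt))
          Metric.ball_subset_closedBall
      filter_upwards [this] with z hz using hmax hz
    obtain ⟨hb, hc, ha⟩ := hη' (f z0)
    have eb : trF f G a b c = trF f G b a c := by ext z; unfold trF; ring
    have ec : trF f G a b c = trF f G c a b := by ext z; unfold trF; ring
    rcases le_total (trX (f z0 - a)) (trX (f z0 - b)) with h1 | h1 <;>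
    rcases le_total (trX (f z0 - a)) (trX (f z0 - c)) with h2 | h2 <;>
    rcases le_total (trX (f z0 - b)) (trX (f z0 - c)) with h3 | h3
    case inl.inl.inl | inl.inl.inr =>
      exact tr_local f hf hnc a b c hab hac G hG hGe z0 hlt η hη h1 h2 (hb (Or.inl h1))
        (hc (Or.inl h2)) hmax'
    case inr.inl.inl | inr.inr.inl =>
      rw [eb] at hmax' ⊢
      exact tr_local f hf hnc b a c hab.symm hbc G hG (fun z => by rw [hGe]; ring) z0 hlt η hη
        h1 h3 (ha (Or.inl h1)) (hc (Or.inr h3)) hmax'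
    case inl.inr.inl | inl.inr.inr | inr.inr.inr | inr.inl.inr =>
      rw [ec] at hmax' ⊢
      exact tr_local f hf hnc c a b hac.symm hbc.symm G hG (fun z => by rw [hGe]; ring) z0 hlt η hη
        (by linarith) (by linarith) (ha (Or.inr (by linarith))) (hb (Or.inr (by linarith))) hmax'
  · simp only [trF, heq]
    norm_num
    positivity

lemma tr_eta_one (a b : ℂ) (hab : a ≠ b) : ∃ η > 0, ∀ w, trX (w - a) ≤ trX (w - b) →
    ∀ η' ≤ η, η' * (1 + trX (w - b)) ≤ trX (w - b) := by
  set d := trX ((a - b) / 2) with hd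
  have hd0 : 0 < d := trX_pos (div_ne_zero (sub_ne_zero.mpr hab) two_ne_zero)
  refine ⟨d / (1 + d), by positivity, fun w hw η' hη' => ?_⟩
  have hx := trX_nonneg (w - b)
  have h1 : d ≤ trX (w - b) := by
    refine le_of_pow_le_pow_left₀ (n := 4) (by norm_num) hx ?_
    have h2 : trX (w - a)^4 ≤ trX (w - b)^4 := by
      have := trX_nonneg (w - a)
      gcongr
    rw [trX_pow, trX_pow] at h2
    rw [hd, trX_pow, trX_pow, norm_div]
    have h3 := norm_sub_le (w - b) (w - a)
    rw [show w - b - (w - a) = a - b by ring] at h3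
    norm_num
    linarith
  calc η' * (1 + trX (w - b)) ≤ d / (1 + d) * (1 + trX (w - b)) := by gcongr
    _ ≤ _ := by
      rw [div_mul_eq_mul_div, div_le_iff₀ (by positivity)]
      nlinarith

lemma tr_eta (a b c : ℂ) (hab : a ≠ b) (hac : a ≠ c) (hbc : b ≠ c) : ∃ η : ℝ, 0 < η ∧
    ∀ w, (trX (w - a) ≤ trX (w - b) ∨ trX (w - c) ≤ trX (w - b) →
        η * (1 + trX (w - b)) ≤ trX (w - b)) ∧
      (trX (w - a) ≤ trX (w - c) ∨ trX (w - b) ≤ trX (w - c) →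
        η * (1 + trX (w - c)) ≤ trX (w - c)) ∧
      (trX (w - b) ≤ trX (w - a) ∨ trX (w - c) ≤ trX (w - a) →
        η * (1 + trX (w - a)) ≤ trX (w - a)) := by
  obtain ⟨e1, p1, h1⟩ := tr_eta_one a b hab
  obtain ⟨e2, p2, h2⟩ := tr_eta_one c b hbc.symm
  obtain ⟨e3, p3, h3⟩ := tr_eta_one a c hac
  obtain ⟨e4, p4, h4⟩ := tr_eta_one b c hbc
  obtain ⟨e5, p5, h5⟩ := tr_eta_one b a hab.symm
  obtain ⟨e6, p6, h6⟩ := tr_eta_one c a hac.symm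
  refine ⟨min e1 (min e2 (min e3 (min e4 (min e5 e6)))), by positivity, fun w => ⟨?_, ?_, ?_⟩⟩ <;>
  rintro (h | h)
  · exact h1 w h _ (by simp)
  · exact h2 w h _ (by simp)
  · exact h3 w h _ (by simp)
  · exact h4 w h _ (by simp)
  · exact h5 w h _ (by simp)
  · exact h6 w h _ (by simp)

lemma tr_three (f : ℂ → ℂ) (hf : Differentiable ℂ f) (hnc : ∃ z w : ℂ, f z ≠ f w)
    (a b c : ℂ) (hab : a ≠ b) (hac : a ≠ c) (hbc : b ≠ c)
    (ha : ∀ z, f z = a → deriv f z = 0) (hb : ∀ z, f z = b → deriv f z = 0)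
    (hc : ∀ z, f z = c → deriv f z = 0) : False := by
  obtain ⟨G, hG, hGe⟩ := tr_exists_G f hf hnc a b c hab hac hbc ha hb hc
  obtain ⟨η, hη, hη'⟩ := tr_eta a b c hab hac hbc
  have hG0 : ∀ z1, G z1 = 0 := by
    intro z1
    have hbd : ∀ R : ℝ, 0 < R → R^2 * ‖G z1‖ ≤ 128 / η^8 := by
      intro R hR
      have hRc : (R : ℂ) ≠ 0 := by exact_mod_cast hR.ne'
      have hl : ∀ z : ℂ, HasDerivAt (fun z : ℂ => R * z + z1) R z := fun z => by
        simpa using ((hasDerivAt_id z).const_mul (R : ℂ)).add_const z1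
      have hd : ∀ z, HasDerivAt (fun z => f (R * z + z1)) (deriv f (R * z + z1) * R) z := fun z =>
        (hf (R * z + z1)).hasDerivAt.comp z (hl z)
      have := tr_global (fun z => f (R * z + z1)) (fun z => (hd z).differentiableAt) ?_ a b c
        hab hac hbc η hη hη' (fun z => R^2 * G (R * z + z1))
        (fun z => ((hG _).comp z (hl z).differentiableAt).const_mul _) ?_
      · simpa [abs_of_pos hR] using this
      · obtain ⟨z, w, hzw⟩ := hnc
        refine ⟨(z - z1) / R, (w - z1) / R, ?_⟩
        simpa [mul_div_cancel₀ _ hRc] using hzw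
      · intro z
        rw [(hd z).deriv, mul_pow, hGe]
        ring
    by_contra hne
    have hp := norm_pos_iff.mpr hne
    have hC : 0 < 128 / η^8 := by positivity
    have h := hbd (√((128 / η^8 + 1) / ‖G z1‖)) (by positivity)
    rw [Real.sq_sqrt (by positivity), div_mul_cancel₀ _ hp.ne'] at h
    linarith
  obtain ⟨z, w, hzw⟩ := hnc
  apply hzw
  apply is_const_of_deriv_eq_zero hf
  intro z
  have := hGe z
  rw [hG0, zero_mul] at this
  exact pow_eq_zero_iff (two_ne_zero) |>.mp this

/-- A nonconstant entire function has at most two finite totally ramified values. -/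
theorem entire_at_most_two_totally_ramified_values
    (f : ℂ → ℂ) (hf : Differentiable ℂ f)
    (hnc : ∃ z w : ℂ, f z ≠ f w) :
    {a : ℂ | ∀ z : ℂ, f z = a → deriv f z = 0}.encard ≤ 2 := by
  by_contra hcon
  rw [not_le] at hcon
  have h3 := Order.add_one_le_of_lt hcon
  rw [show (2 : ℕ∞) + 1 = 3 by norm_num] at h3
  obtain ⟨t, hts, ht⟩ := Set.exists_subset_encard_eq h3
  obtain ⟨a, b, c, hab, hac, hbc, rfl⟩ := Set.encard_eq_three.mp ht
  exact tr_three f hf hnc a b c hab hac hbc (hts (by simp)) (hts (by simp)) (hts (by simp))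
end
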